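/- (Sanders' iteration lemma.) Let K ≥ 1 be a real number, ε ∈ (0,1), and let n be a natural number with (1−ε)^n · K < 1. Define t_j = 1/(2K)^{2^j − 1} for j ≥ 0 (so t_0 = 1 and t_{j+1} = t_j²/(2K)). Then for every function f : (0,1] → [1,K] there exists i < n such that f(t_{i+1}) ≥ (1−ε)·f(t_i). In particular, there is t > 1/(2K)^{2^n − 1} with f(t²/(2K)) ≥ (1−ε)·f(t), where n depends only on K and ε. -/

import Mathlib

/-- Sanders' iteration lemma: for `f : (0,1] → [1,K]`, `ε ∈ (0,1)` and `n` with
`(1-ε)ⁿ·K < 1`, setting `t_j = 1/(2K)^(2^j - 1)`, there is `i < n` with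
`f(t_{i+1}) ≥ (1-ε)·f(t_i)`; in particular there is `t > 1/(2K)^(2^n - 1)` with
`f(t²/(2K)) ≥ (1-ε)·f(t)`. -/
theorem sanders_iteration_lemma (K ε : ℝ) (hK : 1 ≤ K)
    (hε : ε ∈ Set.Ioo (0 : ℝ) 1) (n : ℕ) (hn : (1 - ε) ^ n * K < 1)
    (f : ℝ → ℝ) (hf : ∀ x : ℝ, 0 < x → x ≤ 1 → 1 ≤ f x ∧ f x ≤ K) :
    (∃ i < n,
        (1 - ε) * f (1 / (2 * K) ^ (2 ^ i - 1)) ≤ f (1 / (2 * K) ^ (2 ^ (i + 1) - 1))) ∧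
      ∃ t : ℝ, 1 / (2 * K) ^ (2 ^ n - 1) < t ∧ (1 - ε) * f t ≤ f (t ^ 2 / (2 * K)) := by
  obtain ⟨hε0, hε1⟩ := hε
  have h1 : (1 : ℝ) < 2 * K := by linarith
  have first : ∃ i < n,
      (1 - ε) * f (1 / (2 * K) ^ (2 ^ i - 1)) ≤ f (1 / (2 * K) ^ (2 ^ (i + 1) - 1)) := by
    by_contra! hcon
    have key : ∀ j, j ≤ n →
        f (1 / (2 * K) ^ (2 ^ j - 1)) ≤ (1 - ε) ^ j * K := by
      intro j
      induction j with
      | zero =>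
        intro _
        simpa using (hf 1 one_pos le_rfl).2
      | succ j ih =>
        intro hj
        have h2 := hcon j (by omega)
        have h3 := mul_le_mul_of_nonneg_left (ih (by omega)) (by linarith : 0 ≤ 1 - ε)
        have h4 : (1 - ε) ^ (j + 1) * K = (1 - ε) * ((1 - ε) ^ j * K) := by ring
        linarith
    have hpow : (1 : ℝ) ≤ (2 * K) ^ (2 ^ n - 1) := one_le_pow₀ h1.le
    have h5 := (hf (1 / (2 * K) ^ (2 ^ n - 1)) (by positivity)
      (by rw [div_le_one (by positivity)]; exact hpow)).1
    linarith [key n le_rfl]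
  refine ⟨first, ?_⟩
  obtain ⟨i, hi, h⟩ := first
  have hp : 2 ^ i < 2 ^ n := Nat.pow_lt_pow_right (by norm_num) hi
  have hp0 : 0 < 2 ^ i := by positivity
  refine ⟨1 / (2 * K) ^ (2 ^ i - 1), ?_, ?_⟩
  · exact one_div_lt_one_div_of_lt (by positivity) (pow_lt_pow_right₀ h1 (by omega))
  · have he : 2 ^ (i + 1) - 1 = (2 ^ i - 1) * 2 + 1 := by
      rw [pow_succ]; omega
    have heq : (1 / (2 * K) ^ (2 ^ i - 1)) ^ 2 / (2 * K)
        = 1 / (2 * K) ^ (2 ^ (i + 1) - 1) := by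
      rw [he, pow_succ (2 * K) ((2 ^ i - 1) * 2), pow_mul, div_pow, one_pow, div_div]
    rw [heq]
    exact h
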